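/- arXiv:1601.00558 — 2 statements merged into one kernel-verified Lean document; each statement's English description precedes it below -/
import Mathlib

section
/- For every integer n = 2k+1 with k ≥ 2 and all positive integers p, q such that p is even, n divides p, p ≥ 3n+1, q is odd, and q ≥ 3n, the p×q rectangle admits a (regular) tiling by T_n. -/
open scoped BigOperators Classical

/-- Translate a tile (a set of cells in `ℤ × ℤ`) by a vector `v`. -/
def tileTranslate (v : ℤ × ℤ) (T : Set (ℤ × ℤ)) : Set (ℤ × ℤ) := (fun c => v + c) '' T

/-- The ribbon L `n`-omino `T1 = {(0,j) : 0 ≤ j ≤ n-2} ∪ {(1,0)}`. -/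
def T1 (n : ℕ) : Set (ℤ × ℤ) :=
  {c | c.1 = 0 ∧ 0 ≤ c.2 ∧ c.2 ≤ (n : ℤ) - 2} ∪ {((1 : ℤ), (0 : ℤ))}

/-- The ribbon L `n`-omino `T2 = {(0,n-2)} ∪ {(1,j) : 0 ≤ j ≤ n-2}`. -/
def T2 (n : ℕ) : Set (ℤ × ℤ) :=
  {((0 : ℤ), (n : ℤ) - 2)} ∪ {c | c.1 = 1 ∧ 0 ≤ c.2 ∧ c.2 ≤ (n : ℤ) - 2}

/-- The ribbon L `n`-omino `T3 = {(i,0) : 0 ≤ i ≤ n-2} ∪ {(0,1)}`. -/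
def T3 (n : ℕ) : Set (ℤ × ℤ) :=
  {c | c.2 = 0 ∧ 0 ≤ c.1 ∧ c.1 ≤ (n : ℤ) - 2} ∪ {((0 : ℤ), (1 : ℤ))}

/-- The ribbon L `n`-omino `T4 = {(i,1) : 0 ≤ i ≤ n-2} ∪ {(n-2,0)}`. -/
def T4 (n : ℕ) : Set (ℤ × ℤ) :=
  {c | c.2 = 1 ∧ 0 ≤ c.1 ∧ c.1 ≤ (n : ℤ) - 2} ∪ {(((n : ℤ) - 2), (0 : ℤ))}

/-- The tile set `T_n` of the four ribbon L `n`-ominoes. -/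
def TileSet (n : ℕ) : Set (Set (ℤ × ℤ)) := {T1 n, T2 n, T3 n, T4 n}

/-- `w` is a signed tiling of the region `R` by the tile set `tiles`:
a finitely supported integer weight on placements `(T, v)`, supported on placements of
tiles from `tiles`, such that for each cell the weights of placements covering it sum to
`1` inside `R` and `0` outside. -/
def IsSignedTiling (tiles : Set (Set (ℤ × ℤ))) (R : Set (ℤ × ℤ))
    (w : Set (ℤ × ℤ) × (ℤ × ℤ) → ℤ) : Prop :=
  (Function.support w).Finite ∧
  (∀ p, w p ≠ 0 → p.1 ∈ tiles) ∧
  ∀ c : ℤ × ℤ,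
    (∑ᶠ p ∈ {p : Set (ℤ × ℤ) × (ℤ × ℤ) | c ∈ tileTranslate p.2 p.1}, w p) =
      if c ∈ R then 1 else 0

/-- `P` is a (regular) tiling of the region `R` by the tile set `tiles`: a finite
collection of placements of tiles from `tiles` whose translated copies are pairwise
disjoint and cover exactly `R`. -/
def IsTiling (tiles : Set (Set (ℤ × ℤ))) (R : Set (ℤ × ℤ))
    (P : Finset (Set (ℤ × ℤ) × (ℤ × ℤ))) : Prop :=
  (∀ p ∈ P, p.1 ∈ tiles) ∧
  (∀ p ∈ P, ∀ q ∈ P, p ≠ q → Disjoint (tileTranslate p.2 p.1) (tileTranslate q.2 q.1)) ∧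
  (⋃ p ∈ P, tileTranslate p.2 p.1) = R

/-- The `p × q` rectangle (height `p`, base `q`) with lower-left corner at the origin. -/
def Rect (p q : ℕ) : Set (ℤ × ℤ) :=
  {c | 0 ≤ c.1 ∧ c.1 ≤ (q : ℤ) - 1 ∧ 0 ≤ c.2 ∧ c.2 ≤ (p : ℤ) - 1}

/-- A region is tileable by `tiles` if it admits a regular tiling. -/
def Tileable (tiles : Set (Set (ℤ × ℤ))) (R : Set (ℤ × ℤ)) : Prop :=
  ∃ P, IsTiling tiles R P

/-- The `w × h` box (width `w`, height `h`) with lower-left corner `(x, y)`. -/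
def box (x y w h : ℤ) : Set (ℤ × ℤ) :=
  {c | x ≤ c.1 ∧ c.1 < x + w ∧ y ≤ c.2 ∧ c.2 < y + h}

theorem mem_box {x y w h : ℤ} {c : ℤ × ℤ} :
    c ∈ box x y w h ↔ x ≤ c.1 ∧ c.1 < x + w ∧ y ≤ c.2 ∧ c.2 < y + h := Iff.rfl

theorem mem_tileTranslate {v c : ℤ × ℤ} {T : Set (ℤ × ℤ)} :
    c ∈ tileTranslate v T ↔ (c.1 - v.1, c.2 - v.2) ∈ T := by
  constructor
  · rintro ⟨d, hd, rfl⟩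
    simpa using hd
  · intro h
    exact ⟨_, h, by ext <;> simp⟩

namespace Tileable

variable {tiles : Set (Set (ℤ × ℤ))} {R A B : Set (ℤ × ℤ)}

theorem of_empty (h : ∀ c, c ∉ R) : Tileable tiles R :=
  ⟨∅, by simp, by simp, by simpa using (Set.eq_empty_of_forall_notMem h).symm⟩

theorem tile {T : Set (ℤ × ℤ)} (hT : T ∈ tiles) (v : ℤ × ℤ) :
    Tileable tiles (tileTranslate v T) :=
  ⟨{(T, v)}, by simpa using hT, by simp +contextual, by simp⟩

theorem union (hA : Tileable tiles A) (hB : Tileable tiles B)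
    (hdisj : ∀ c, c ∈ A → c ∉ B) : Tileable tiles (A ∪ B) := by
  obtain ⟨P, hP, hPd, rfl⟩ := hA
  obtain ⟨Q, hQ, hQd, rfl⟩ := hB
  have cross : ∀ p ∈ P, ∀ q ∈ Q,
      Disjoint (tileTranslate p.2 p.1) (tileTranslate q.2 q.1) := fun p hp q hq =>
    Set.disjoint_left.2 fun c hcp hcq =>
      hdisj c (Set.mem_biUnion hp hcp) (Set.mem_biUnion hq hcq)
  refine ⟨P ∪ Q, ?_, ?_, ?_⟩
  · intro p hp
    exact (Finset.mem_union.1 hp).elim (hP p) (hQ p)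
  · intro p hp q hq hpq
    rcases Finset.mem_union.1 hp with hp | hp <;> rcases Finset.mem_union.1 hq with hq | hq
    · exact hPd p hp q hq hpq
    · exact cross p hp q hq
    · exact (cross q hq p hp).symm
    · exact hQd p hp q hq hpq
  · rw [Finset.set_biUnion_union]

theorem congr (hA : Tileable tiles A) (h : ∀ c, c ∈ A ↔ c ∈ R) : Tileable tiles R :=
  Set.ext h ▸ hA

end Tileable

section Ribbon

variable {n : ℕ}

/-- A box of width `2` and height `n` splits into one copy of `T1` and one of `T2`. -/
theorem tileable_box_two_n (hn : 2 ≤ n) (x y : ℤ) : Tileable (TileSet n) (box x y 2 n) := by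
  refine ((Tileable.tile (T := T1 n) (by simp [TileSet]) (x, y)).union
    (Tileable.tile (T := T2 n) (by simp [TileSet]) (x, y + 1)) ?_).congr ?_ <;> rintro ⟨a, b⟩ <;>
  simp only [mem_tileTranslate, T1, T2, mem_box, Set.mem_union, Set.mem_ofPred_eq,
    Set.mem_singleton_iff, Prod.mk.injEq] <;> omega

/-- A box of width `n` and height `2` splits into one copy of `T3` and one of `T4`. -/
theorem tileable_box_n_two (hn : 2 ≤ n) (x y : ℤ) : Tileable (TileSet n) (box x y n 2) := by
  refine ((Tileable.tile (T := T3 n) (by simp [TileSet]) (x, y)).union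
    (Tileable.tile (T := T4 n) (by simp [TileSet]) (x + 1, y)) ?_).congr ?_ <;> rintro ⟨a, b⟩ <;>
  simp only [mem_tileTranslate, T3, T4, mem_box, Set.mem_union, Set.mem_ofPred_eq,
    Set.mem_singleton_iff, Prod.mk.injEq] <;> omega

variable {tiles : Set (Set (ℤ × ℤ))}

/-- Stacking `m` tileable boxes on top of each other gives a tileable box. -/
theorem tileable_box_mul_height {w h : ℤ} (hh : 0 ≤ h) (H : ∀ x y, Tileable tiles (box x y w h))
    (m : ℕ) (x y : ℤ) : Tileable tiles (box x y w (m * h)) := by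
  induction m with
  | zero => exact .of_empty fun c => by simp only [mem_box]; push_cast; lia
  | succ m ih =>
    have hm : 0 ≤ (m : ℤ) * h := by positivity
    refine (ih.union (H x (y + m * h)) ?_).congr ?_ <;> intro c <;>
      simp only [Set.mem_union, mem_box, Nat.cast_succ, add_one_mul] <;>
      generalize (m : ℤ) * h = s at * <;> omega

/-- Putting `m` tileable boxes side by side gives a tileable box. -/
theorem tileable_box_mul_width {w h : ℤ} (hw : 0 ≤ w) (H : ∀ x y, Tileable tiles (box x y w h))
    (m : ℕ) (x y : ℤ) : Tileable tiles (box x y (m * w) h) := by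
  induction m with
  | zero => exact .of_empty fun c => by simp only [mem_box]; push_cast; lia
  | succ m ih =>
    have hm : 0 ≤ (m : ℤ) * w := by positivity
    refine (ih.union (H (x + m * w) y) ?_).congr ?_ <;> intro c <;>
      simp only [Set.mem_union, mem_box, Nat.cast_succ, add_one_mul] <;>
      generalize (m : ℤ) * w = s at * <;> omega

/-- Boxes of even width whose height is a multiple of `n` are tileable. -/
theorem tileable_box_even_width (hn : 2 ≤ n) (i j : ℕ) (x y : ℤ) :
    Tileable (TileSet n) (box x y (i * 2) (j * n)) :=
  tileable_box_mul_width (by simp)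
    (tileable_box_mul_height (by simp) (tileable_box_two_n hn) j) i x y

/-- Boxes of even height whose width is a multiple of `n` are tileable. -/
theorem tileable_box_even_height (hn : 2 ≤ n) (i j : ℕ) (x y : ℤ) :
    Tileable (TileSet n) (box x y (j * n) (i * 2)) :=
  tileable_box_mul_height (by simp)
    (tileable_box_mul_width (by simp) (tileable_box_n_two hn) j) i x y

/-- For odd `n ≥ 3`, the box of width `3n` and height `2n + 2` is tileable: a `T2` and a `T3`
meeting in the middle are surrounded by boxes with one even side and the other equal to `n`
or `2n`. -/
theorem tileable_box_three_mul (k : ℕ) (hk : 1 ≤ k) :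
    Tileable (TileSet (2 * k + 1)) (box 0 0 (3 * (2 * k + 1)) (4 * k + 4)) := by
  have hn : 2 ≤ 2 * k + 1 := by omega
  -- bottom left, bottom right and middle left boxes
  have h₁ := tileable_box_even_width hn (2 * k + 1) 1 0 0
  have h₂ := tileable_box_even_height hn 1 1 (4 * k + 2) 0
  have h₃ := tileable_box_even_height hn 1 1 0 (2 * k + 1)
  -- the two unpaired tiles
  have t₂ : Tileable (TileSet (2 * k + 1)) _ :=
    Tileable.tile (T := T2 (2 * k + 1)) (by simp [TileSet]) (4 * k + 1, 2)
  have t₃ : Tileable (TileSet (2 * k + 1)) _ :=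
    Tileable.tile (T := T3 (2 * k + 1)) (by simp [TileSet]) (2 * k + 1, 2 * k + 1)
  -- right, top middle and top left boxes
  have h₄ := tileable_box_even_width hn k 2 (4 * k + 3) 2
  have h₅ := tileable_box_even_height hn (k + 1) 1 (2 * k + 2) (2 * k + 2)
  have h₆ := tileable_box_even_width hn (k + 1) 1 0 (2 * k + 3)
  push_cast at *
  refine ((((((((h₁.union h₂ ?_).union h₃ ?_).union t₂ ?_).union t₃ ?_).union h₄ ?_).union
    h₅ ?_).union h₆ ?_).congr ?_) <;> rintro ⟨a, b⟩ <;>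
  simp only [mem_tileTranslate, T2, T3, mem_box, Set.mem_union, Set.mem_ofPred_eq,
    Set.mem_singleton_iff, Prod.mk.injEq, Nat.cast_add, Nat.cast_mul,
    Nat.cast_ofNat, Nat.cast_one] <;> omega

end Ribbon

/-- For every integer `n = 2k+1` with `k ≥ 2` and all positive integers `p, q` such that
`p` is even, `n ∣ p`, `p ≥ 3n+1`, `q` is odd and `q ≥ 3n`, the `p × q` rectangle admits
a regular tiling by `T_n`. -/
theorem rect_tiling_of_even_div_large (k : ℕ) (hk : 2 ≤ k) (p q : ℕ)
    (hp : 0 < p) (hq : 0 < q)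
    (hpe : Even p) (hpd : (2 * k + 1) ∣ p) (hpl : 3 * (2 * k + 1) + 1 ≤ p)
    (hqo : Odd q) (hql : 3 * (2 * k + 1) ≤ q) :
    ∃ P, IsTiling (TileSet (2 * k + 1)) (Rect p q) P := by
  have hn : 2 ≤ 2 * k + 1 := by omega
  obtain ⟨j, hj⟩ := hpd
  obtain ⟨r, hr⟩ := hpe
  obtain ⟨s, hs⟩ := hqo
  obtain ⟨i, hi⟩ : ∃ i, p = 4 * k + 4 + i * 2 := ⟨r - (2 * k + 2), by omega⟩
  obtain ⟨l, hl⟩ : ∃ l, q = 3 * (2 * k + 1) + l * 2 := ⟨s - (3 * k + 1), by omega⟩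
  have core := tileable_box_three_mul k (by omega)
  have top := tileable_box_even_height hn i 3 0 (4 * k + 4)
  have side := tileable_box_even_width hn l j (3 * (2 * k + 1)) 0
  rw [show (j : ℤ) * ((2 * k + 1 : ℕ) : ℤ) = p by rw [hj]; push_cast; ring] at side
  refine ((core.union top ?_).union side ?_).congr ?_ <;> rintro ⟨a, b⟩ <;>
  simp only [Rect, mem_box, Set.mem_union, Set.mem_ofPred_eq] <;>
  push_cast <;> omega
end

section
/- For every integer n = 2k+1 with k ≥ 2 and every positive integer m such that m is even and n does not divide m, the m-inflated copy of the L n-omino admits no (regular) tiling by T_n. -/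
open scoped BigOperators Classical

/-- The `m`-inflated copy of the L `n`-omino: each cell of
`L = {(0,j) : 0 ≤ j ≤ n-2} ∪ {(1,0)}` is replaced by an `m × m` block. -/
def InflatedL (n m : ℕ) : Set (ℤ × ℤ) :=
  {c | 0 ≤ c.1 ∧ c.1 ≤ (m : ℤ) - 1 ∧ 0 ≤ c.2 ∧ c.2 ≤ ((n : ℤ) - 1) * m - 1} ∪
  {c | (m : ℤ) ≤ c.1 ∧ c.1 ≤ 2 * (m : ℤ) - 1 ∧ 0 ≤ c.2 ∧ c.2 ≤ (m : ℤ) - 1}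

section Tiles

variable (n : ℕ) (v : ℤ × ℤ) (x y : ℤ)

lemma mem_tileTranslate_iff (T : Set (ℤ × ℤ)) :
    (x, y) ∈ tileTranslate v T ↔ (x - v.1, y - v.2) ∈ T := by
  obtain ⟨v₁, v₂⟩ := v
  simp only [tileTranslate, Set.mem_image, Prod.exists, Prod.mk_add_mk, Prod.mk.injEq]
  constructor
  · rintro ⟨a, b, h, rfl, rfl⟩
    simpa using h
  · exact fun h ↦ ⟨_, _, h, by omega, by omega⟩

lemma mem_tileTranslate_T1 : (x, y) ∈ tileTranslate v (T1 n) ↔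
    (x = v.1 ∧ v.2 ≤ y ∧ y ≤ v.2 + n - 2) ∨ (x = v.1 + 1 ∧ y = v.2) := by
  simp only [mem_tileTranslate_iff, T1, Set.mem_union, Set.mem_ofPred_eq, Set.mem_singleton_iff,
    Prod.mk.injEq]
  omega

lemma mem_tileTranslate_T2 : (x, y) ∈ tileTranslate v (T2 n) ↔
    (x = v.1 ∧ y = v.2 + n - 2) ∨ (x = v.1 + 1 ∧ v.2 ≤ y ∧ y ≤ v.2 + n - 2) := by
  simp only [mem_tileTranslate_iff, T2, Set.mem_union, Set.mem_ofPred_eq, Set.mem_singleton_iff,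
    Prod.mk.injEq]
  omega

lemma mem_tileTranslate_T3 : (x, y) ∈ tileTranslate v (T3 n) ↔
    (y = v.2 ∧ v.1 ≤ x ∧ x ≤ v.1 + n - 2) ∨ (x = v.1 ∧ y = v.2 + 1) := by
  simp only [mem_tileTranslate_iff, T3, Set.mem_union, Set.mem_ofPred_eq, Set.mem_singleton_iff,
    Prod.mk.injEq]
  omega

lemma mem_tileTranslate_T4 : (x, y) ∈ tileTranslate v (T4 n) ↔
    (y = v.2 + 1 ∧ v.1 ≤ x ∧ x ≤ v.1 + n - 2) ∨ (x = v.1 + n - 2 ∧ y = v.2) := by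
  simp only [mem_tileTranslate_iff, T4, Set.mem_union, Set.mem_ofPred_eq, Set.mem_singleton_iff,
    Prod.mk.injEq]
  omega

end Tiles

/-- A region in which every cell has at most one predecessor (to its left or above it) and at most
one successor (to its right or below it), the predecessor being absent only on the diagonal
`x - y = a + 1` and the successor only on `x - y = b`. -/
structure IsRibbon (C : Set (ℤ × ℤ)) (a b : ℤ) : Prop where
  pred : ∀ x y, (x, y) ∈ C → ((x - 1, y) ∈ C ∧ (x, y + 1) ∉ C) ∨
    ((x - 1, y) ∉ C ∧ (x, y + 1) ∈ C) ∨ ((x - 1, y) ∉ C ∧ (x, y + 1) ∉ C ∧ x - y = a + 1)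
  succ : ∀ x y, (x, y) ∈ C → ((x + 1, y) ∈ C ∧ (x, y - 1) ∉ C) ∨
    ((x + 1, y) ∉ C ∧ (x, y - 1) ∈ C) ∨ ((x + 1, y) ∉ C ∧ (x, y - 1) ∉ C ∧ x - y = b)

section Ribbon

variable {n : ℕ} (v : ℤ × ℤ)

lemma isRibbon_T1 (hn : 3 ≤ n) :
    IsRibbon (tileTranslate v (T1 n)) (v.1 - v.2 + 1 - n) (v.1 - v.2 + 1) := by
  constructor <;> intro x y <;> simp only [mem_tileTranslate_T1] <;> omega

lemma isRibbon_T2 (hn : 3 ≤ n) :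
    IsRibbon (tileTranslate v (T2 n)) (v.1 - v.2 + 1 - n) (v.1 - v.2 + 1) := by
  constructor <;> intro x y <;> simp only [mem_tileTranslate_T2] <;> omega

lemma isRibbon_T3 (hn : 3 ≤ n) :
    IsRibbon (tileTranslate v (T3 n)) (v.1 - v.2 - 2) (v.1 - v.2 - 2 + n) := by
  constructor <;> intro x y <;> simp only [mem_tileTranslate_T3] <;> omega

lemma isRibbon_T4 (hn : 3 ≤ n) :
    IsRibbon (tileTranslate v (T4 n)) (v.1 - v.2 - 2) (v.1 - v.2 - 2 + n) := by
  constructor <;> intro x y <;> simp only [mem_tileTranslate_T4] <;> omega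

end Ribbon

variable {K : Type*} [Field K] {ζ : K}

/-- The potential `U` on lattice points increases along a horizontal edge starting on the diagonal
`d = x - y` by `ζ ^ (-d)` and is constant along a vertical edge, except for the edges
interior to the ribbon `C`, where its increments are corrected so as to close up around each cell
(in characteristic two). -/
structure IsHeight (ζ : K) (C : Set (ℤ × ℤ)) (a : ℤ) (U : ℤ → ℤ → K) : Prop where
  bottom : ∀ x y, (x, y) ∈ C →
    U (x + 1) y = U x y + if (x, y - 1) ∈ C then ζ ^ (-a) else ζ ^ (y - x)
  left : ∀ x y, (x, y) ∈ C →
    U x (y + 1) = U x y + if (x - 1, y) ∈ C then ζ ^ (-a) + ζ ^ (y - (x - 1)) else 0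

/-- The contribution of the horizontal edge starting at `(x, y)` to the contour integral of `U`. -/
def edgeTerm (ζ : K) (U : ℤ → ℤ → K) (x y : ℤ) : K := U x y * ζ ^ (x - y)

/-- The contour integral of `U` around a cell. -/
def cellTerm (ζ : K) (U : ℤ → ℤ → K) (c : ℤ × ℤ) : K :=
  edgeTerm ζ U c.1 c.2 + edgeTerm ζ U c.1 (c.2 + 1)

lemma sum_range_add_succ (h2 : (2 : K) = 0) (g : ℕ → K) (m : ℕ) :
    ∑ j ∈ Finset.range m, (g j + g (j + 1)) = g 0 + g m := by
  induction m with
  | zero => simp only [Finset.range_zero, Finset.sum_empty]; linear_combination -g 0 * h2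
  | succ m ih => rw [Finset.sum_range_succ, ih]; linear_combination g m * h2

lemma sum_cellTerm_column (h2 : (2 : K) = 0) (U : ℤ → ℤ → K) (x y : ℤ) (m : ℕ) :
    ∑ j ∈ Finset.range m, cellTerm ζ U (x, y + j) = edgeTerm ζ U x y + edgeTerm ζ U x (y + m) := by
  convert sum_range_add_succ h2 (fun j : ℕ ↦ edgeTerm ζ U x (y + j)) m using 2 with j
  · simp [cellTerm, add_assoc]
  · simp

lemma height_row (hζ : ζ ≠ 0) {U : ℤ → ℤ → K} {x y : ℤ} {m : ℕ}
    (hb : ∀ j : ℕ, j < m → U (x + j + 1) y = U (x + j) y + ζ ^ (y - (x + j))) :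
    U (x + m) y = U x y + ζ ^ (y - x) * ∑ j ∈ Finset.range m, ζ⁻¹ ^ j := by
  induction m with
  | zero => simp
  | succ m ih =>
    have e : ζ ^ (y - (x + m)) = ζ ^ (y - x) * ζ⁻¹ ^ m := by
      rw [← sub_sub, zpow_sub₀ hζ, zpow_natCast, inv_pow, div_eq_mul_inv]
    rw [Finset.sum_range_succ, mul_add, ← add_assoc, ← ih fun j hj ↦ hb j (by omega), ← e,
      ← hb m (by omega)]
    push_cast
    rw [add_assoc]

lemma sum_cellTerm_row (h2 : (2 : K) = 0) (hζ : ζ ≠ 0) {U : ℤ → ℤ → K} {x y a : ℤ} {m : ℕ}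
    (h0 : U x (y + 1) = U x y)
    (hb : ∀ j : ℕ, j < m → U (x + j + 1) y = U (x + j) y + ζ ^ (y - (x + j)))
    (hl : ∀ j : ℕ, j < m →
      U (x + j + 1) (y + 1) = U (x + j + 1) y + (ζ ^ (-a) + ζ ^ (y - (x + j)))) :
    ∑ j ∈ Finset.range (m + 1), cellTerm ζ U (x + j, y) =
      U (x + m) y * ζ ^ (x - y + m) + U x y * ζ ^ (x - y - 1) +
        ζ ^ (x - y - a) * ∑ j ∈ Finset.range m, ζ ^ j := by
  induction m with
  | zero =>
    simp [cellTerm, edgeTerm, h0, sub_sub]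
  | succ m ih =>
    rw [Finset.sum_range_succ, ih (fun j hj ↦ hb j (by omega)) (fun j hj ↦ hl j (by omega)),
      Finset.sum_range_succ]
    simp only [cellTerm, edgeTerm]
    push_cast
    rw [← add_assoc x, hl m (by omega), hb m (by omega)]
    have e : ζ ^ (-a) * ζ ^ (x - y + m) = ζ ^ (x - y - a) * ζ ^ m := by
      rw [← zpow_natCast, ← zpow_add₀ hζ, ← zpow_add₀ hζ]; ring_nf
    rw [show x + m + 1 - (y + 1) = x - y + m by ring,
      show x + m + 1 - y = x - y + (m + 1) by ring]
    generalize ζ ^ (x - y + m : ℤ) = p at *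
    generalize ζ ^ (y - (x + m) : ℤ) = q at *
    linear_combination e + (U (x + m) y * p + q * p) * h2

lemma exists_finset_insert_image (K : Type*) [AddCommMonoid K] {T : Set (ℤ × ℤ)} {f : ℕ → ℤ × ℤ}
    (hf : f.Injective) {m : ℕ} {q : ℤ × ℤ} (hq : ∀ j < m, f j ≠ q)
    (hT : ∀ c, c ∈ T ↔ c = q ∨ ∃ j < m, f j = c) :
    ∃ C : Finset (ℤ × ℤ), (C : Set (ℤ × ℤ)) = T ∧ C.card = m + 1 ∧
      ∀ F : ℤ × ℤ → K, ∑ c ∈ C, F c = F q + ∑ j ∈ Finset.range m, F (f j) := by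
  have hq' : q ∉ (Finset.range m).image f := by simpa using hq
  refine ⟨insert q ((Finset.range m).image f), ?_, ?_, fun F ↦ ?_⟩
  · ext c
    simp [hT]
  · rw [Finset.card_insert_of_notMem hq', Finset.card_image_of_injective _ hf, Finset.card_range]
  · rw [Finset.sum_insert hq', Finset.sum_image hf.injOn]

section TileSum

variable {r : ℕ} {v : ℤ × ℤ} {U : ℤ → ℤ → K}

lemma sum_cellTerm_T1 (h2 : (2 : K) = 0) (hζ : ζ ^ (r + 3) = 1)
    (hU : IsHeight ζ (tileTranslate v (T1 (r + 3))) (v.1 - v.2 + 1 - (r + 3 : ℕ)) U) :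
    cellTerm ζ U (v.1 + 1, v.2) + ∑ j ∈ Finset.range (r + 2), cellTerm ζ U (v.1, v.2 + j) =
      ζ + ζ⁻¹ := by
  have hζ0 : ζ ≠ 0 := by rintro rfl; simp at hζ
  obtain ⟨x, y⟩ := v
  obtain ⟨hb, hl⟩ := hU
  simp only [mem_tileTranslate_T1] at hb hl ⊢
  have hcol : ∀ j : ℕ, j ≤ r + 2 → U x (y + j) = U x y := by
    intro j hj
    induction j with
    | zero => simp
    | succ j ih =>
      have := hl x (y + j) (by omega)
      rw [if_neg (by omega), ih (by omega)] at this
      rw [← add_zero (U x y), ← this]; push_cast; ring_nf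
  have h1 := hb x y (by omega)
  have h3 := hl (x + 1) y (by omega)
  rw [if_neg (by omega)] at h1
  rw [if_pos (by omega)] at h3
  have htop := hcol (r + 2) le_rfl
  rw [sum_cellTerm_column h2]
  simp only [cellTerm, edgeTerm, htop, h3, h1]
  have e1 : ζ ^ (-(x - y + 1 - (r + 3 : ℕ) : ℤ)) = ζ ^ (y - x) * ζ⁻¹ := by
    rw [show -(x - y + 1 - (r + 3 : ℕ) : ℤ) = (y - x) + (-1) + (r + 3 : ℕ) by ring,
      zpow_add₀ hζ0, zpow_natCast, hζ, zpow_add₀ hζ0]; simp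
  have e2 : ζ ^ (x - (y + (r + 2 : ℕ))) = ζ ^ (x - y) * ζ := by
    rw [show x - (y + (r + 2 : ℕ)) = (x - y) + 1 - (r + 3 : ℕ) by push_cast; ring,
      zpow_sub₀ hζ0, zpow_natCast, hζ, zpow_add₀ hζ0]; simp
  have e3 : ζ ^ (y - x) = (ζ ^ (x - y))⁻¹ := by rw [← zpow_neg]; ring_nf
  have e4 : ζ ^ (x + 1 - y) = ζ ^ (x - y) * ζ := by
    rw [show x + 1 - y = x - y + 1 by ring, zpow_add₀ hζ0]; simp
  rw [e1, e2, add_sub_add_right_eq_sub, show y - (x + 1 - 1) = y - x by ring, e3, e4]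
  have hz := zpow_ne_zero (x - y) hζ0
  generalize ζ ^ (x - y) = z at *
  field_simp
  grind

lemma sum_cellTerm_T2 (h2 : (2 : K) = 0) (hζ : ζ ^ (r + 3) = 1)
    (hU : IsHeight ζ (tileTranslate v (T2 (r + 3))) (v.1 - v.2 + 1 - (r + 3 : ℕ)) U) :
    cellTerm ζ U (v.1, v.2 + (r + 1)) +
      ∑ j ∈ Finset.range (r + 2), cellTerm ζ U (v.1 + 1, v.2 + j) = ζ + ζ⁻¹ := by
  have hζ0 : ζ ≠ 0 := by rintro rfl; simp at hζ
  obtain ⟨x, y⟩ := v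
  obtain ⟨hb, hl⟩ := hU
  simp only [mem_tileTranslate_T2] at hb hl ⊢
  have hcol : ∀ j : ℕ, j ≤ r + 1 → U (x + 1) (y + j) = U (x + 1) y := by
    intro j hj
    induction j with
    | zero => simp
    | succ j ih =>
      have := hl (x + 1) (y + j) (by omega)
      rw [if_neg (by omega), ih (by omega)] at this
      rw [← add_zero (U (x + 1) y), ← this]; push_cast; ring_nf
  have h1 := hb x (y + (r + 1)) (by omega)
  have h3 := hl x (y + (r + 1)) (by omega)
  have h4 := hl (x + 1) (y + (r + 1)) (by omega)
  rw [if_neg (by omega)] at h1 h3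
  rw [if_pos (by omega)] at h4
  have htop := hcol (r + 1) le_rfl
  push_cast at htop
  rw [htop] at h1 h4
  rw [sum_cellTerm_column h2]
  have h5 : U x (y + (r + 1)) = U (x + 1) y + ζ ^ (y + (r + 1) - x) := by
    linear_combination -h1 - ζ ^ (y + (r + 1) - x) * h2
  have hr : y + ((r + 2 : ℕ) : ℤ) = y + (r + 1) + 1 := by push_cast; ring
  simp only [cellTerm, edgeTerm, hr, h3, h4, h5]
  have e1 : ζ ^ (-(x - y + 1 - (r + 3 : ℕ) : ℤ)) = ζ ^ (y - x) * ζ⁻¹ := by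
    rw [show -(x - y + 1 - (r + 3 : ℕ) : ℤ) = (y - x) + (-1) + (r + 3 : ℕ) by ring,
      zpow_add₀ hζ0, zpow_natCast, hζ, zpow_add₀ hζ0]; simp
  have e2 : ζ ^ (x - (y + (r + 1))) = ζ ^ (x - y) * ζ * ζ := by
    rw [show x - (y + (r + 1)) = (x - y) + 1 + 1 - (r + 3 : ℕ) by push_cast; ring,
      zpow_sub₀ hζ0, zpow_natCast, hζ, zpow_add₀ hζ0, zpow_add₀ hζ0]; simp
  have e2' : ζ ^ (x - (y + (r + 1) + 1)) = ζ ^ (x - y) * ζ := by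
    rw [← sub_sub, zpow_sub₀ hζ0, e2]; field_simp
  have e3 : ζ ^ (y - x) = (ζ ^ (x - y))⁻¹ := by rw [← zpow_neg]; ring_nf
  have e4 : ζ ^ (x + 1 - y) = ζ ^ (x - y) * ζ := by
    rw [show x + 1 - y = x - y + 1 by ring, zpow_add₀ hζ0]; simp
  have e5 : ζ ^ (y + (r + 1) - x) = (ζ ^ (x - y) * ζ * ζ)⁻¹ := by
    rw [← e2, ← zpow_neg]; ring_nf
  rw [e1, e2, e2', add_sub_add_right_eq_sub, e2, show y + (r + 1 : ℤ) - (x + 1 - 1) =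
    y + (r + 1) - x by ring, e5, e3, e4]
  have hz := zpow_ne_zero (x - y) hζ0
  generalize ζ ^ (x - y) = z at *
  field_simp
  grind

lemma geom_sum_of_pow_eq_one (h2 : (2 : K) = 0) (hζ : ζ ^ (r + 3) = 1) (h1 : ζ ≠ 1) :
    ∑ j ∈ Finset.range (r + 1), ζ ^ j = ζ⁻¹ + ζ⁻¹ ^ 2 := by
  have hζ0 : ζ ≠ 0 := by rintro rfl; simp at hζ
  have := geom_sum_mul ζ (r + 1)
  have h3 : ζ ^ (r + 1) * ζ ^ 2 = 1 := by rw [← pow_add, hζ]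
  apply mul_right_cancel₀ (sub_ne_zero.2 h1)
  rw [this]
  field_simp
  linear_combination h3 + (1 - ζ ^ 2) * h2

lemma sum_cellTerm_T3 (h2 : (2 : K) = 0) (hζ : ζ ^ (r + 3) = 1) (h1 : ζ ≠ 1)
    (hU : IsHeight ζ (tileTranslate v (T3 (r + 3))) (v.1 - v.2 - 2) U) :
    cellTerm ζ U (v.1, v.2 + 1) + ∑ j ∈ Finset.range (r + 2), cellTerm ζ U (v.1 + j, v.2) =
      ζ + ζ⁻¹ := by
  have hζ0 : ζ ≠ 0 := by rintro rfl; simp at hζ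
  obtain ⟨x, y⟩ := v
  obtain ⟨hb, hl⟩ := hU
  simp only [mem_tileTranslate_T3] at hb hl ⊢
  have h0 := hl x y (by omega)
  have h0' := hl x (y + 1) (by omega)
  rw [if_neg (by omega), add_zero] at h0 h0'
  rw [h0] at h0'
  have hrow : ∀ j : ℕ, j < r + 1 → U (x + j + 1) y = U (x + j) y + ζ ^ (y - (x + j)) :=
    fun j hj ↦ by rw [hb (x + j) y (by omega), if_neg (by omega)]
  have hx := height_row hζ0 hrow
  have hs := sum_cellTerm_row (m := r + 1) (a := x - y - 2) h2 hζ0 h0 hrow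
    (fun j hj ↦ by rw [hl (x + j + 1) y (by omega), if_pos (by omega)]; ring_nf)
  have hζ' : ζ⁻¹ ^ (r + 3) = 1 := by rw [inv_pow, hζ, inv_one]
  rw [hs, hx, geom_sum_of_pow_eq_one h2 hζ h1, geom_sum_of_pow_eq_one h2 hζ' (by simpa using h1)]
  simp only [cellTerm, edgeTerm, h0, h0']
  have e1 : ζ ^ (x - y + (r + 1 : ℕ)) = ζ ^ (x - y) * ζ⁻¹ ^ 2 := by
    rw [show x - y + (r + 1 : ℕ) = (x - y) + (-2) + (r + 3 : ℕ) by push_cast; ring,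
      zpow_add₀ hζ0, zpow_natCast, hζ, zpow_add₀ hζ0, mul_one, zpow_neg, inv_pow, zpow_ofNat]
  have e2 : ζ ^ (x - y - 1) = ζ ^ (x - y) * ζ⁻¹ := zpow_sub_one₀ hζ0 _
  have e3 : ζ ^ (y - x) = (ζ ^ (x - y))⁻¹ := by rw [← zpow_neg]; ring_nf
  rw [← sub_sub, ← sub_sub, ← sub_sub, zpow_sub_one₀ hζ0 (x - y - 1), e1, e2, e3,
    show x - y - (x - y - 2) = ((2 : ℕ) : ℤ) by simp, zpow_natCast]
  have hz := zpow_ne_zero (x - y) hζ0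
  generalize ζ ^ (x - y) = z at *
  field_simp
  grind

lemma sum_cellTerm_T4 (h2 : (2 : K) = 0) (hζ : ζ ^ (r + 3) = 1) (h1 : ζ ≠ 1)
    (hU : IsHeight ζ (tileTranslate v (T4 (r + 3))) (v.1 - v.2 - 2) U) :
    cellTerm ζ U (v.1 + (r + 1 : ℕ), v.2) +
      ∑ j ∈ Finset.range (r + 2), cellTerm ζ U (v.1 + j, v.2 + 1) = ζ + ζ⁻¹ := by
  have hζ0 : ζ ≠ 0 := by rintro rfl; simp at hζ
  obtain ⟨x, y⟩ := v
  obtain ⟨hb, hl⟩ := hU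
  simp only [mem_tileTranslate_T4] at hb hl ⊢
  have h0 := hl x (y + 1) (by omega)
  have h0' := hl (x + (r + 1 : ℕ)) y (by omega)
  rw [if_neg (by omega), add_zero] at h0 h0'
  have hrow : ∀ j : ℕ, j < r + 1 →
      U (x + j + 1) (y + 1) = U (x + j) (y + 1) + ζ ^ (y + 1 - (x + j)) :=
    fun j hj ↦ by rw [hb (x + j) (y + 1) (by omega), if_neg (by omega)]
  have hx := height_row hζ0 hrow
  have hs := sum_cellTerm_row (m := r + 1) (a := x - y - 2) h2 hζ0 h0 hrow
    (fun j hj ↦ by rw [hl (x + j + 1) (y + 1) (by omega), if_pos (by omega)]; ring_nf)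
  have hζ' : ζ⁻¹ ^ (r + 3) = 1 := by rw [inv_pow, hζ, inv_one]
  rw [hs]
  simp only [cellTerm, edgeTerm, ← h0']
  rw [hx, geom_sum_of_pow_eq_one h2 hζ h1, geom_sum_of_pow_eq_one h2 hζ' (by simpa using h1)]
  have e1 : ζ ^ (x - y + (r + 1 : ℕ)) = ζ ^ (x - y) * ζ⁻¹ ^ 2 := by
    rw [show x - y + (r + 1 : ℕ) = (x - y) + (-2) + (r + 3 : ℕ) by push_cast; ring,
      zpow_add₀ hζ0, zpow_natCast, hζ, zpow_add₀ hζ0, mul_one, zpow_neg, inv_pow, zpow_ofNat]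
  have e2 : ζ ^ (x - y - 1) = ζ ^ (x - y) * ζ⁻¹ := zpow_sub_one₀ hζ0 _
  have e3 : ζ ^ (y - x) = (ζ ^ (x - y))⁻¹ := by rw [← zpow_neg]; ring_nf
  rw [show x + (r + 1 : ℕ) - y = x - y + (r + 1 : ℕ) by ring,
    show x + (r + 1 : ℕ) - (y + 1) = x - y + (r + 1 : ℕ) - 1 by ring,
    show x - (y + 1) + (r + 1 : ℕ) = x - y + (r + 1 : ℕ) - 1 by ring,
    show x - (y + 1) - 1 = x - y - 1 - 1 by ring,
    show y + 1 - x = y - x + 1 by ring, zpow_add_one₀ hζ0,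
    zpow_sub_one₀ hζ0 (x - y - 1), zpow_sub_one₀ hζ0 (x - y + (r + 1 : ℕ)), e1, e2, e3,
    show x - (y + 1) - (x - y - 2) = 1 by ring, zpow_one]
  have hz := zpow_ne_zero (x - y) hζ0
  generalize ζ ^ (x - y) = z at *
  field_simp
  grind

end TileSum

/-- Every tiling by ribbons of a region whose rows are intervals starting at abscissa zero carries
a common height function. -/
lemma exists_isHeight (h2 : (2 : K) = 0) (hζ0 : ζ ≠ 0) {n : ℕ} (hζ : ζ ^ n = 1) {ι : Type*}
    {s : Finset ι} {C : ι → Set (ℤ × ℤ)} {a : ι → ℤ} {R : Set (ℤ × ℤ)}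
    (hdisj : ∀ i ∈ s, ∀ j ∈ s, i ≠ j → Disjoint (C i) (C j))
    (hR : ∀ c, c ∈ R ↔ ∃ i ∈ s, c ∈ C i)
    (hC : ∀ i ∈ s, IsRibbon (C i) (a i) (a i + n))
    (hrow : ∀ x y, (x, y) ∈ R → 0 ≤ x ∧ ∀ i, 0 ≤ i → i ≤ x → (i, y) ∈ R) :
    ∃ U : ℤ → ℤ → K, (∀ i ∈ s, IsHeight ζ (C i) (a i) U) ∧ (∀ y, U 0 y = 0) ∧
      (∀ x y, 0 ≤ x → (x, y - 1) ∉ R ∨ (x, y) ∉ R → U (x + 1) y = U x y + ζ ^ (y - x)) ∧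
      ∀ x y, (x, y) ∈ R → (x + 1, y) ∉ R → U (x + 1) (y + 1) = U (x + 1) y := by
  have huniq : ∀ i ∈ s, ∀ j ∈ s, ∀ c, c ∈ C i → c ∈ C j → i = j := fun i hi j hj c hci hcj ↦ by
    by_contra h
    exact Set.disjoint_left.1 (hdisj i hi j hj h) hci hcj
  have hlab : ∀ c, ∃ l : ℤ, ∀ i ∈ s, c ∈ C i → a i = l := fun c ↦ by
    by_cases h : ∃ i ∈ s, c ∈ C i
    · obtain ⟨i, hi, hc⟩ := h
      exact ⟨a i, fun j hj hcj ↦ by rw [huniq i hi j hj c hc hcj]⟩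
    · exact ⟨0, fun i hi hc ↦ (h ⟨i, hi, hc⟩).elim⟩
  choose lab hlab using hlab
  let linked (c c' : ℤ × ℤ) : Prop := ∃ i ∈ s, c ∈ C i ∧ c' ∈ C i
  have linked_left : ∀ i ∈ s, ∀ c ∈ C i, ∀ c', linked c' c ↔ c' ∈ C i := fun i hi c hc c' ↦
    ⟨fun ⟨j, hj, hc', hcj⟩ ↦ huniq i hi j hj c hc hcj ▸ hc', fun h ↦ ⟨i, hi, h, hc⟩⟩
  have linked_right : ∀ i ∈ s, ∀ c ∈ C i, ∀ c', linked c c' ↔ c' ∈ C i := fun i hi c hc c' ↦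
    ⟨fun ⟨j, hj, hcj, hc'⟩ ↦ huniq i hi j hj c hc hcj ▸ hc', fun h ↦ ⟨i, hi, hc, h⟩⟩
  have linked_mem : ∀ c c', linked c c' → c ∈ R ∧ c' ∈ R := fun c c' ⟨i, hi, hc, hc'⟩ ↦
    ⟨(hR c).2 ⟨i, hi, hc⟩, (hR c').2 ⟨i, hi, hc'⟩⟩
  let H (x y : ℤ) : K := if linked (x, y - 1) (x, y) then ζ ^ (-lab (x, y)) else ζ ^ (y - x)
  let V (x y : ℤ) : K :=
    if linked (x - 1, y) (x, y) then ζ ^ (-lab (x, y)) + ζ ^ (y - (x - 1)) else 0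
  have hH : ∀ i ∈ s, ∀ x y, (x, y) ∈ C i →
      H x y = if (x, y - 1) ∈ C i then ζ ^ (-a i) else ζ ^ (y - x) := fun i hi x y hc ↦ by
    simp only [H, linked_left i hi _ hc, hlab _ i hi hc]
  have hV : ∀ i ∈ s, ∀ x y, (x, y) ∈ C i →
      V x y = if (x - 1, y) ∈ C i then ζ ^ (-a i) + ζ ^ (y - (x - 1)) else 0 :=
    fun i hi x y hc ↦ by
      simp only [V, linked_left i hi _ hc, hlab _ i hi hc]
  have hH' : ∀ i ∈ s, ∀ x y, (x, y) ∈ C i →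
      H x (y + 1) = if (x, y + 1) ∈ C i then ζ ^ (-a i) else ζ ^ (y + 1 - x) :=
    fun i hi x y hc ↦ by
      simp only [H, add_sub_cancel_right, linked_right i hi _ hc]
      split_ifs with h
      · rw [hlab _ i hi h]
      · rfl
  have hV' : ∀ i ∈ s, ∀ x y, (x, y) ∈ C i →
      V (x + 1) y = if (x + 1, y) ∈ C i then ζ ^ (-a i) + ζ ^ (y - x) else 0 :=
    fun i hi x y hc ↦ by
      simp only [V, add_sub_cancel_right, linked_right i hi _ hc]
      split_ifs with h
      · rw [hlab _ i hi h]
      · rfl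
  have hclosed : ∀ x y, (x, y) ∈ R → H x y + V (x + 1) y = V x y + H x (y + 1) := by
    intro x y hxy
    obtain ⟨i, hi, hc⟩ := (hR _).1 hxy
    rw [hH i hi x y hc, hV i hi x y hc, hH' i hi x y hc, hV' i hi x y hc]
    trans ζ ^ (-a i)
    · obtain ⟨h, h'⟩ | ⟨h, h'⟩ | ⟨h, h', h3⟩ := (hC i hi).succ x y hc
      · rw [if_pos h, if_neg h']; linear_combination ζ ^ (y - x) * h2
      · rw [if_neg h, if_pos h', add_zero]
      · rw [if_neg h, if_neg h', add_zero, show y - x = -a i - (n : ℤ) by omega, zpow_sub₀ hζ0,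
          zpow_natCast, hζ, div_one]
    · obtain ⟨h, h'⟩ | ⟨h, h'⟩ | ⟨h, h', h3⟩ := (hC i hi).pred x y hc
      · rw [if_pos h, if_neg h', show y + 1 - x = y - (x - 1) by ring]
        linear_combination -ζ ^ (y - (x - 1)) * h2
      · rw [if_neg h, if_pos h', zero_add]
      · rw [if_neg h, if_neg h', zero_add, show y + 1 - x = -a i by omega]
  let U (x y : ℤ) : K := ∑ i ∈ Finset.range x.toNat, H i y
  have hUH : ∀ x y, 0 ≤ x → U (x + 1) y = U x y + H x y := by
    intro x y hx
    lift x to ℕ using hx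
    simp only [U, Int.toNat_natCast, Int.toNat_natCast_add_one, Finset.sum_range_succ]
  have hUV : ∀ (x : ℕ) y, (∀ i < x, ((i : ℤ), y) ∈ R) → U x (y + 1) = U x y + V x y := by
    intro x y h
    induction x with
    | zero =>
      have : ¬ linked ((0 : ℕ) - 1, y) ((0 : ℕ), y) := fun h0 ↦ by
        have := (hrow _ _ (linked_mem _ _ h0).1).1
        omega
      simp only [U, V, if_neg this]
      simp
    | succ x ih =>
      have h1 := ih fun i hi ↦ h i (by omega)
      have h3 := hclosed x y (h x (by omega))
      push_cast
      rw [hUH _ _ (by omega), hUH _ _ (by omega), h1]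
      linear_combination -h3
  have hUV' : ∀ x y, (x, y) ∈ R →
      U x (y + 1) = U x y + V x y ∧ U (x + 1) (y + 1) = U (x + 1) y + V (x + 1) y := by
    intro x y hxy
    obtain ⟨hx, h⟩ := hrow x y hxy
    lift x to ℕ using hx
    exact ⟨hUV x y fun i hi ↦ h i (by omega) (by omega),
      by exact_mod_cast hUV (x + 1) y fun i hi ↦ h i (by omega) (by omega)⟩
  refine ⟨U, fun i hi ↦ ⟨fun x y hc ↦ ?_, fun x y hc ↦ ?_⟩, fun y ↦ by simp [U],
    fun x y hx h ↦ ?_, fun x y h h' ↦ ?_⟩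
  · rw [hUH _ _ (hrow x y ((hR _).2 ⟨i, hi, hc⟩)).1, hH i hi x y hc]
  · rw [(hUV' x y ((hR _).2 ⟨i, hi, hc⟩)).1, hV i hi x y hc]
  · have : ¬ linked (x, y - 1) (x, y) := fun h0 ↦
      h.elim (· (linked_mem _ _ h0).1) (· (linked_mem _ _ h0).2)
    rw [hUH x y hx]
    simp only [H, if_neg this]
  · have : ¬ linked (x + 1 - 1, y) (x + 1, y) := fun h0 ↦ h' (linked_mem _ _ h0).2
    rw [(hUV' x y h).2]
    simp only [V, if_neg this, add_zero]

/-- Each translated tile is a ribbon on which the contour integrals of a height function add up to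
`ζ + ζ⁻¹`. -/
lemma exists_finset_of_mem_tileSet (h2 : (2 : K) = 0) {r : ℕ} (hζ : ζ ^ (r + 3) = 1) (h1 : ζ ≠ 1)
    {T : Set (ℤ × ℤ)} (hT : T ∈ TileSet (r + 3)) (v : ℤ × ℤ) :
    ∃ (C : Finset (ℤ × ℤ)) (a : ℤ), (C : Set (ℤ × ℤ)) = tileTranslate v T ∧ C.card = r + 3 ∧
      IsRibbon (tileTranslate v T) a (a + (r + 3 : ℕ)) ∧
      ∀ U, IsHeight ζ (tileTranslate v T) a U → ∑ c ∈ C, cellTerm ζ U c = ζ + ζ⁻¹ := by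
  have hn : 3 ≤ r + 3 := by omega
  have hcol : ∀ x y : ℤ, (fun j : ℕ ↦ (x, y + j)).Injective := fun x y i j h ↦ by simpa using h
  have hrow : ∀ x y : ℤ, (fun j : ℕ ↦ (x + j, y)).Injective := fun x y i j h ↦ by simpa using h
  obtain rfl | rfl | rfl | rfl := hT
  · obtain ⟨C, hC, hcard, hsum⟩ := exists_finset_insert_image K (T := tileTranslate v (T1 (r + 3)))
      (hcol v.1 v.2) (m := r + 2) (q := (v.1 + 1, v.2)) (by simp) (fun ⟨x, y⟩ ↦ by
        rw [mem_tileTranslate_T1]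
        simp only [Prod.mk.injEq]
        constructor
        · rintro (h | h)
          · exact .inr ⟨(y - v.2).toNat, by omega, by omega, by omega⟩
          · exact .inl h
        · rintro (h | ⟨j, h⟩) <;> omega)
    refine ⟨C, _, hC, hcard, ?_, fun U hU ↦ (hsum _).trans (sum_cellTerm_T1 h2 hζ hU)⟩
    simpa using isRibbon_T1 v hn
  · obtain ⟨C, hC, hcard, hsum⟩ := exists_finset_insert_image K (T := tileTranslate v (T2 (r + 3)))
      (hcol (v.1 + 1) v.2) (m := r + 2) (q := (v.1, v.2 + (r + 1))) (by simp) (fun ⟨x, y⟩ ↦ by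
        rw [mem_tileTranslate_T2]
        simp only [Prod.mk.injEq]
        constructor
        · rintro (h | h)
          · exact .inl ⟨by omega, by omega⟩
          · exact .inr ⟨(y - v.2).toNat, by omega, by omega, by omega⟩
        · rintro (h | ⟨j, h⟩) <;> omega)
    refine ⟨C, _, hC, hcard, ?_, fun U hU ↦ (hsum _).trans (sum_cellTerm_T2 h2 hζ hU)⟩
    simpa using isRibbon_T2 v hn
  · obtain ⟨C, hC, hcard, hsum⟩ := exists_finset_insert_image K (T := tileTranslate v (T3 (r + 3)))
      (hrow v.1 v.2) (m := r + 2) (q := (v.1, v.2 + 1)) (by simp) (fun ⟨x, y⟩ ↦ by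
        rw [mem_tileTranslate_T3]
        simp only [Prod.mk.injEq]
        constructor
        · rintro (h | h)
          · exact .inr ⟨(x - v.1).toNat, by omega, by omega, by omega⟩
          · exact .inl h
        · rintro (h | ⟨j, h⟩) <;> omega)
    exact ⟨C, _, hC, hcard, isRibbon_T3 v hn,
      fun U hU ↦ (hsum _).trans (sum_cellTerm_T3 h2 hζ h1 hU)⟩
  · obtain ⟨C, hC, hcard, hsum⟩ := exists_finset_insert_image K (T := tileTranslate v (T4 (r + 3)))
      (hrow v.1 (v.2 + 1)) (m := r + 2) (q := (v.1 + (r + 1 : ℕ), v.2)) (by simp) (fun ⟨x, y⟩ ↦ by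
        rw [mem_tileTranslate_T4]
        simp only [Prod.mk.injEq]
        constructor
        · rintro (h | h)
          · exact .inr ⟨(x - v.1).toNat, by omega, by omega, by omega⟩
          · exact .inl ⟨by omega, by omega⟩
        · rintro (h | ⟨j, h⟩) <;> omega)
    exact ⟨C, _, hC, hcard, isRibbon_T4 v hn,
      fun U hU ↦ (hsum _).trans (sum_cellTerm_T4 h2 hζ h1 hU)⟩

lemma sum_inflatedL {M : Type*} [AddCommMonoid M] {r m : ℕ} {R : Finset (ℤ × ℤ)}
    (hR : (R : Set (ℤ × ℤ)) = InflatedL (r + 3) m) (F : ℤ × ℤ → M) :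
    ∑ c ∈ R, F c = ∑ i ∈ Finset.range m, ∑ j ∈ Finset.range ((r + 2) * m), F (i, 0 + j) +
      ∑ i ∈ Finset.range m, ∑ j ∈ Finset.range m, F (m + i, 0 + j) := by
  have hmul : ((r + 3 : ℕ) - 1 : ℤ) * m = ((r + 2) * m : ℕ) := by push_cast; ring
  let e (x : ℤ) (p : ℕ × ℕ) : ℤ × ℤ := (x + p.1, 0 + p.2)
  have he : ∀ x, (e x).Injective := fun x p q h ↦ by
    simp only [e, Prod.mk.injEq] at h
    ext <;> omega
  have : R = (Finset.range m ×ˢ Finset.range ((r + 2) * m)).image (e 0) ∪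
      (Finset.range m ×ˢ Finset.range m).image (e m) := by
    ext ⟨x, y⟩
    rw [← Finset.mem_coe, hR]
    simp only [InflatedL, hmul, Set.mem_union, Set.mem_ofPred_eq, Finset.mem_union,
      Finset.mem_image, Finset.mem_product, Finset.mem_range, Prod.exists, Prod.mk.injEq, e]
    refine or_congr ⟨fun h ↦ ⟨x.toNat, y.toNat, ?_⟩, ?_⟩
      ⟨fun h ↦ ⟨(x - m).toNat, y.toNat, ?_⟩, ?_⟩
    · omega
    · rintro ⟨i, j, h⟩; omega
    · omega
    · rintro ⟨i, j, h⟩; omega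
  rw [this, Finset.sum_union, Finset.sum_image (he 0).injOn, Finset.sum_image (he m).injOn,
    Finset.sum_product, Finset.sum_product]
  · simp [e]
  · rw [Finset.disjoint_left]
    rintro ⟨x, y⟩
    simp only [Finset.mem_image, Finset.mem_product, Finset.mem_range, Prod.exists,
      Prod.mk.injEq, e]
    rintro ⟨i, j, h⟩ ⟨i', j', h'⟩
    omega

/-- The contour integral of a height function around the boundary of the inflated L. -/
lemma sum_cellTerm_inflatedL (h2 : (2 : K) = 0) {r m : ℕ} (hζ : ζ ^ (r + 3) = 1)
    {R : Finset (ℤ × ℤ)} (hR : (R : Set (ℤ × ℤ)) = InflatedL (r + 3) m) {U : ℤ → ℤ → K}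
    (hU0 : ∀ y, U 0 y = 0)
    (hUH : ∀ x y, 0 ≤ x → (x, y - 1) ∉ InflatedL (r + 3) m ∨ (x, y) ∉ InflatedL (r + 3) m →
      U (x + 1) y = U x y + ζ ^ (y - x))
    (hUV : ∀ x y, (x, y) ∈ InflatedL (r + 3) m → (x + 1, y) ∉ InflatedL (r + 3) m →
      U (x + 1) (y + 1) = U (x + 1) y) :
    ∑ c ∈ R, cellTerm ζ U c = (∑ j ∈ Finset.range m, ζ⁻¹ ^ j) * (ζ ^ m + (ζ ^ m)⁻¹) *
      ∑ j ∈ Finset.range m, ζ ^ j := by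
  have hζ0 : ζ ≠ 0 := by rintro rfl; simp at hζ
  have hmul : ((r + 3 : ℕ) - 1 : ℤ) * m = ((r + 2) * m : ℕ) := by push_cast; ring
  have hle : m ≤ (r + 2) * m := Nat.le_mul_of_pos_left m (by omega)
  have hqh : ζ ^ ((r + 2) * m) = (ζ ^ m)⁻¹ := by
    apply eq_inv_of_mul_eq_one_left
    rw [← pow_add, ← Nat.succ_mul, pow_mul, hζ, one_pow]
  simp only [InflatedL, hmul, Set.mem_union, Set.mem_ofPred_eq] at hUH hUV
  generalize hh : (r + 2) * m = h at *
  rw [sum_inflatedL hR, hh]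
  have hbot (i : ℕ) : U i 0 = ∑ j ∈ Finset.range i, ζ⁻¹ ^ j := by
    simpa [hU0] using height_row hζ0 (U := U) (x := 0) (y := 0) (m := i)
      fun j _ ↦ hUH _ _ (by omega) (by omega)
  have hbot' (i : ℕ) : U (m + i) 0 =
      ∑ j ∈ Finset.range m, ζ⁻¹ ^ j + (ζ ^ m)⁻¹ * ∑ j ∈ Finset.range i, ζ⁻¹ ^ j := by
    simpa [hbot] using height_row hζ0 (U := U) (x := m) (y := 0) (m := i)
      fun j _ ↦ hUH _ _ (by omega) (by omega)
  have htop (i : ℕ) : U i h = (ζ ^ m)⁻¹ * ∑ j ∈ Finset.range i, ζ⁻¹ ^ j := by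
    simpa [hU0, hqh] using height_row hζ0 (U := U) (x := 0) (y := h) (m := i)
      fun j _ ↦ hUH _ _ (by omega) (by omega)
  have hside (j : ℕ) (hj : m + j ≤ h) : U m (m + j) = U m m := by
    induction j with
    | zero => simp
    | succ j ih =>
      rw [← ih (by omega)]
      obtain rfl | hm := m.eq_zero_or_pos
      · simp [hU0]
      · simpa [add_assoc] using hUV (m - 1) (m + j) (by omega) (by omega)
  have htop' (i : ℕ) : U (m + i) m =
      (ζ ^ m)⁻¹ * ∑ j ∈ Finset.range m, ζ⁻¹ ^ j + ∑ j ∈ Finset.range i, ζ⁻¹ ^ j := by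
    have h3 := hside (h - m) (by omega)
    rw [show (m : ℤ) + (h - m : ℕ) = h by omega, htop] at h3
    simpa [← h3] using height_row hζ0 (U := U) (x := m) (y := m) (m := i)
      fun j _ ↦ hUH _ _ (by omega) (by omega)
  simp only [sum_cellTerm_column h2]
  simp only [edgeTerm, zero_add, hbot, hbot', htop, htop']
  rw [← Finset.sum_add_distrib, Finset.mul_sum (Finset.range m) (fun j ↦ ζ ^ j) (_ * (_ + _))]
  refine Finset.sum_congr rfl fun i _ ↦ ?_
  have hq : ζ ^ m ≠ 0 := pow_ne_zero _ hζ0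
  have e1 : ζ ^ ((i : ℤ) - h) = ζ ^ i * ζ ^ m := by
    rw [zpow_sub₀ hζ0, zpow_natCast, zpow_natCast, hqh, div_inv_eq_mul]
  have e2 : ζ ^ ((m : ℤ) + i) = ζ ^ m * ζ ^ i := by
    rw [zpow_add₀ hζ0, zpow_natCast, zpow_natCast]
  rw [e1, add_sub_cancel_left, sub_zero, sub_zero, e2, zpow_natCast]
  generalize ∑ j ∈ Finset.range m, ζ⁻¹ ^ j = s
  generalize ∑ j ∈ Finset.range i, ζ⁻¹ ^ j = t
  generalize ζ ^ i = z
  generalize ζ ^ m = q at *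
  field_simp
  linear_combination 2 * z * t * q * h2

/-- Over a field of characteristic two containing a suitable root of unity `ζ`, the number of tiles
in a tiling of the inflated L satisfies a relation obtained by integrating a height function. -/
lemma card_tiling_inflatedL (h2 : (2 : K) = 0) {r m : ℕ} (hζ : ζ ^ (r + 3) = 1) (h1 : ζ ≠ 1)
    {P : Finset (Set (ℤ × ℤ) × (ℤ × ℤ))}
    (hP : IsTiling (TileSet (r + 3)) (InflatedL (r + 3) m) P) :
    P.card = m * m ∧ P.card * (ζ + ζ⁻¹) =
      (∑ j ∈ Finset.range m, ζ⁻¹ ^ j) * (ζ ^ m + (ζ ^ m)⁻¹) * ∑ j ∈ Finset.range m, ζ ^ j := by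
  have hζ0 : ζ ≠ 0 := by rintro rfl; simp at hζ
  obtain ⟨hT, hdisj, hcov⟩ := hP
  have hex : ∀ p : Set (ℤ × ℤ) × (ℤ × ℤ), ∃ (C : Finset (ℤ × ℤ)) (a : ℤ), p ∈ P →
      (C : Set (ℤ × ℤ)) = tileTranslate p.2 p.1 ∧ C.card = r + 3 ∧
      IsRibbon (tileTranslate p.2 p.1) a (a + (r + 3 : ℕ)) ∧
      ∀ U, IsHeight ζ (tileTranslate p.2 p.1) a U → ∑ c ∈ C, cellTerm ζ U c = ζ + ζ⁻¹ := by
    intro p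
    by_cases hp : p ∈ P
    · obtain ⟨C, a, h⟩ := exists_finset_of_mem_tileSet h2 hζ h1 (hT p hp) p.2
      exact ⟨C, a, fun _ ↦ h⟩
    · exact ⟨∅, 0, fun h ↦ (hp h).elim⟩
  choose C a hC using hex
  have hmem : ∀ c, c ∈ InflatedL (r + 3) m ↔ ∃ p ∈ P, c ∈ tileTranslate p.2 p.1 := fun c ↦ by
    rw [← hcov]; simp
  have hR : (P.biUnion C : Set (ℤ × ℤ)) = InflatedL (r + 3) m := by
    rw [Finset.coe_biUnion, ← hcov]
    exact Set.iUnion₂_congr fun p hp ↦ (hC p hp).1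
  have hpd : (P : Set (Set (ℤ × ℤ) × (ℤ × ℤ))).PairwiseDisjoint C := fun p hp q hq hpq ↦ by
    rw [Function.onFun, ← Finset.disjoint_coe, (hC p hp).1, (hC q hq).1]
    exact hdisj p hp q hq hpq
  constructor
  · have h3 := sum_inflatedL hR fun _ ↦ 1
    rw [← Finset.card_eq_sum_ones, Finset.card_biUnion hpd,
      Finset.sum_congr rfl fun p hp ↦ (hC p hp).2.1] at h3
    simp only [Finset.sum_const, Finset.card_range, smul_eq_mul, mul_one] at h3
    apply Nat.eq_of_mul_eq_mul_right (show 0 < r + 3 by omega)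
    rw [h3]; ring
  · obtain ⟨U, hU, hU0, hUH, hUV⟩ := exists_isHeight h2 hζ0 hζ hdisj hmem
      (fun p hp ↦ (hC p hp).2.2.1) fun x y h ↦ by
        have hle : (m : ℤ) ≤ ((r + 3 : ℕ) - 1) * m := by
          push_cast; nlinarith [Int.natCast_nonneg m, Int.natCast_nonneg r]
        simp only [InflatedL, Set.mem_union, Set.mem_ofPred_eq] at h ⊢
        generalize ((r + 3 : ℕ) - 1 : ℤ) * m = w at *
        exact ⟨by omega, fun i _ _ ↦ by omega⟩
    rw [← sum_cellTerm_inflatedL h2 hζ hR hU0 hUH hUV, Finset.sum_biUnion hpd,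
      Finset.sum_congr rfl fun p hp ↦ (hC p hp).2.2.2 U (hU p hp), Finset.sum_const, nsmul_eq_mul]

/-- For every integer `n = 2k+1` with `k ≥ 2` and every positive integer `m` which is
even and not divisible by `n`, the `m`-inflated copy of the L `n`-omino admits no
regular tiling by `T_n`. -/
theorem inflatedL_no_tiling_of_even_not_div (k : ℕ) (hk : 2 ≤ k) (m : ℕ) (hm : 0 < m)
    (hme : Even m) (hmd : ¬ (2 * k + 1) ∣ m) :
    ¬ ∃ P, IsTiling (TileSet (2 * k + 1)) (InflatedL (2 * k + 1) m) P := by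
  rintro ⟨P, hP⟩
  obtain ⟨r, rfl⟩ : ∃ r, k = r + 1 := ⟨k - 1, by omega⟩
  have hr : 2 * (r + 1) + 1 = 2 * r + 3 := by ring
  rw [hr] at hP hmd
  have h2 : (2 : AlgebraicClosure (ZMod 2)) = 0 := CharTwo.two_eq_zero
  have : NeZero ((2 * r + 3 : ℕ) : AlgebraicClosure (ZMod 2)) := ⟨by
    rw [Ne, CharP.cast_eq_zero_iff _ 2]; omega⟩
  obtain ⟨ζ, hζ⟩ :=
    HasEnoughRootsOfUnity.exists_primitiveRoot (AlgebraicClosure (ZMod 2)) (2 * r + 3)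
  have hζ1 : ζ ≠ 1 := hζ.ne_one (by omega)
  have hζ0 : ζ ≠ 0 := hζ.ne_zero (by omega)
  obtain ⟨hcard, hsum⟩ := card_tiling_inflatedL h2 hζ.pow_eq_one hζ1 hP
  have hzero : (P.card : AlgebraicClosure (ZMod 2)) = 0 := by
    rw [CharP.cast_eq_zero_iff _ 2, hcard]
    exact hme.two_dvd.mul_left m
  have hq1 : ζ ^ m ≠ 1 := by rwa [Ne, hζ.pow_eq_one_iff_dvd]
  have hq2 : (ζ ^ m) ^ 2 ≠ 1 := by
    rw [← pow_mul, Ne, hζ.pow_eq_one_iff_dvd, Nat.Coprime.dvd_mul_right]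
    · exact hmd
    · rw [Nat.coprime_two_right]
      exact ⟨r + 1, by ring⟩
  rw [hzero, zero_mul, eq_comm, mul_eq_zero, mul_eq_zero] at hsum
  obtain (h | h) | h := hsum
  · have := geom_sum_mul ζ⁻¹ m
    rw [h, zero_mul, eq_comm, sub_eq_zero, inv_pow, inv_eq_one] at this
    exact hq1 this
  · have hq : ζ ^ m ≠ 0 := pow_ne_zero _ hζ0
    apply hq2
    field_simp at h
    linear_combination h - h2
  · have := geom_sum_mul ζ m
    rw [h, zero_mul, eq_comm, sub_eq_zero] at this
    exact hq1 this
end
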